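/- Let k, k', m ∈ ℤ, let ℓ be a positive integer, and let f : ℂ × ℍ → ℂ satisfy the weight-k', index-m Jacobi transformation laws for SL₂(ℤ). Define, for each positive integer d, (T_{k',d} f)(x,τ) := d^{k'−1} · Σ_{a·a'' = d} Σ_{b=0}^{a''−1} (a'')^{−k'} f(a·x, (aτ+b)/a''), the sum running over all factorizations of d into positive integers a, a''. Then the wrong-weight Hecke transform g(x,τ) := Σ_{e·d = ℓ} c_{k,k'}(e) · (T_{k',d} f)(e·x, e·τ), with the sum over all factorizations of ℓ into positive integers e, d, satisfies the weight-k', index-mℓ Jacobi transformation laws for the congruence subgroup Γ₀(ℓ). -/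

import Mathlib

/-- `e(w) = exp(2πi w)`. -/
noncomputable def eC (w : ℂ) : ℂ := Complex.exp (2 * (Real.pi : ℂ) * Complex.I * w)

/-- The set of integer matrices of determinant one, i.e. `SL₂(ℤ)`. -/
def SL2Z : Set (Matrix (Fin 2) (Fin 2) ℤ) := {A | A.det = 1}

/-- The congruence subgroup `Γ₀(N)`: matrices in `SL₂(ℤ)` whose lower-left entry is
divisible by `N`. -/
def Gamma0Set (N : ℕ) : Set (Matrix (Fin 2) (Fin 2) ℤ) :=
  {A | A.det = 1 ∧ (N : ℤ) ∣ A 1 0}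

/-- A function `f : ℂ × ℍ → ℂ` (regarded as a function of two complex variables,
constrained only for `τ` in the upper half-plane) satisfies the weight-`k`,
index-`m` Jacobi transformation laws for a set `Γ` of matrices in `SL₂(ℤ)`:
`f(x/(cτ+d), (aτ+b)/(cτ+d)) = (cτ+d)^k e(cmx²/(cτ+d)) f(x,τ)` for all `(a b; c d) ∈ Γ`,
and `f(x + λτ + μ, τ) = e(-mλ²τ - 2λmx) f(x,τ)` for all `λ, μ ∈ ℤ`. -/
def JacobiLaws (k m : ℤ) (Γ : Set (Matrix (Fin 2) (Fin 2) ℤ)) (f : ℂ → ℂ → ℂ) : Prop :=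
  (∀ A ∈ Γ, ∀ x τ : ℂ, 0 < τ.im →
      f (x / ((A 1 0 : ℂ) * τ + (A 1 1 : ℂ)))
          (((A 0 0 : ℂ) * τ + (A 0 1 : ℂ)) / ((A 1 0 : ℂ) * τ + (A 1 1 : ℂ))) =
        ((A 1 0 : ℂ) * τ + (A 1 1 : ℂ)) ^ k *
          eC ((A 1 0 : ℂ) * (m : ℂ) * x ^ 2 / ((A 1 0 : ℂ) * τ + (A 1 1 : ℂ))) * f x τ) ∧
  (∀ x τ : ℂ, 0 < τ.im → ∀ l μ : ℤ,
      f (x + (l : ℂ) * τ + (μ : ℂ)) τ =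
        eC (-(m : ℂ) * (l : ℂ) ^ 2 * τ - 2 * (l : ℂ) * (m : ℂ) * x) * f x τ)

/-- The arithmetic constant `c_{k,k'}(e) = ∑_{a·b=e} a^{k-1} b^{k'-1} μ(b)`. -/
noncomputable def cConst (k k' : ℤ) (e : ℕ) : ℂ :=
  ∑ a ∈ e.divisors,
    (a : ℂ) ^ (k - 1) * ((e / a : ℕ) : ℂ) ^ (k' - 1) *
      ((ArithmeticFunction.moebius (e / a) : ℤ) : ℂ)

/-- The `d`-th Hecke transform of weight `k'` of a function `f : ℂ × ℍ → ℂ`, computed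
with the upper-triangular coset representatives:
`(T_{k',d} f)(x,τ) = d^{k'-1} ∑_{a·a''=d} ∑_{b=0}^{a''-1} (a'')^{-k'} f(ax, (aτ+b)/a'')`. -/
noncomputable def heckeTransform (k' : ℤ) (d : ℕ) (f : ℂ → ℂ → ℂ) : ℂ → ℂ → ℂ :=
  fun x τ =>
    (d : ℂ) ^ (k' - 1) *
      ∑ a ∈ d.divisors, ∑ b ∈ Finset.range (d / a),
        ((d / a : ℕ) : ℂ) ^ (-k') *
          f ((a : ℂ) * x) (((a : ℂ) * τ + (b : ℂ)) / ((d / a : ℕ) : ℂ))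

lemma eC_add (z w : ℂ) : eC (z + w) = eC z * eC w := by
  simp only [eC, mul_add, Complex.exp_add]

lemma eC_add_intCast (z : ℂ) (n : ℤ) : eC (z + n) = eC z := by
  rw [eC_add, eC, eC, show 2 * (Real.pi : ℂ) * Complex.I * (n : ℂ) =
    n * (2 * (Real.pi : ℂ) * Complex.I) by ring, Complex.exp_int_mul_two_pi_mul_I, mul_one]

/-- The automorphy denominator `cτ + d` of an integer matrix. -/
noncomputable def autDenom (M : Matrix (Fin 2) (Fin 2) ℤ) (τ : ℂ) : ℂ :=
  (M 1 0 : ℂ) * τ + (M 1 1 : ℂ)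

/-- The Möbius action `(aτ + b)/(cτ + d)` of an integer matrix. -/
noncomputable def moebiusAct (M : Matrix (Fin 2) (Fin 2) ℤ) (τ : ℂ) : ℂ :=
  ((M 0 0 : ℂ) * τ + (M 0 1 : ℂ)) / autDenom M τ

lemma autDenom_ne_zero {M : Matrix (Fin 2) (Fin 2) ℤ} (hM : M.det ≠ 0) {τ : ℂ} (hτ : 0 < τ.im) :
    autDenom M τ ≠ 0 := by
  intro h
  have him := congrArg Complex.im h
  have hre := congrArg Complex.re h
  simp only [autDenom, Complex.add_im, Complex.mul_im, Complex.intCast_re, Complex.intCast_im,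
    zero_mul, add_zero, Complex.zero_im, mul_eq_zero, Int.cast_eq_zero, hτ.ne', or_false] at him
  simp only [autDenom, him, Int.cast_zero, zero_mul, zero_add, Complex.intCast_re,
    Complex.zero_re, Int.cast_eq_zero] at hre
  exact hM (by rw [Matrix.det_fin_two, him, hre]; ring)

lemma moebiusAct_im_pos {M : Matrix (Fin 2) (Fin 2) ℤ} (hM : 0 < M.det) {τ : ℂ}
    (hτ : 0 < τ.im) : 0 < (moebiusAct M τ).im := by
  have hn : 0 < Complex.normSq (autDenom M τ) :=
    Complex.normSq_pos.2 (autDenom_ne_zero hM.ne' hτ)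
  have hdet : (0 : ℝ) < (M.det : ℝ) := by exact_mod_cast hM
  have : (moebiusAct M τ).im = M.det * τ.im / Complex.normSq (autDenom M τ) := by
    rw [moebiusAct, Complex.div_im, ← sub_div, Matrix.det_fin_two]
    congr 1
    simp [autDenom]
    ring
  rw [this]
  positivity

lemma autDenom_mul (A B : Matrix (Fin 2) (Fin 2) ℤ) {τ : ℂ} (hB : autDenom B τ ≠ 0) :
    autDenom (A * B) τ = autDenom A (moebiusAct B τ) * autDenom B τ := by
  rw [autDenom, autDenom, moebiusAct, add_mul, mul_assoc, div_mul_cancel₀ _ hB]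
  simp [Matrix.mul_apply, autDenom]
  ring

lemma moebiusAct_mul (A B : Matrix (Fin 2) (Fin 2) ℤ) {τ : ℂ} (hB : autDenom B τ ≠ 0) :
    moebiusAct (A * B) τ = moebiusAct A (moebiusAct B τ) := by
  have h : ((A * B) 0 0 : ℂ) * τ + ((A * B) 0 1 : ℂ) =
      ((A 0 0 : ℂ) * moebiusAct B τ + (A 0 1 : ℂ)) * autDenom B τ := by
    rw [moebiusAct, add_mul, mul_assoc, div_mul_cancel₀ _ hB]
    simp [Matrix.mul_apply, autDenom]
    ring
  rw [moebiusAct, autDenom_mul A B hB, h, mul_div_mul_right _ _ hB, ← moebiusAct]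

/-- The weight-`k`, index-`m` slash action of an integer matrix of positive determinant. -/
noncomputable def jacobiSlash (k m : ℤ) (f : ℂ → ℂ → ℂ) (M : Matrix (Fin 2) (Fin 2) ℤ)
    (x τ : ℂ) : ℂ :=
  autDenom M τ ^ (-k) * eC (-(m * M.det * M 1 0 * x ^ 2 / autDenom M τ)) *
    f (M.det * x / autDenom M τ) (moebiusAct M τ)

/-- The cocycle identity behind the compatibility of the index factors. -/
lemma lowerLeft_mul_cocycle (A B : Matrix (Fin 2) (Fin 2) ℤ) (τ : ℂ) :
    ((A * B) 1 0 : ℂ) * autDenom B τ = A 1 0 * B.det + B 1 0 * autDenom (A * B) τ := by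
  simp [autDenom, Matrix.mul_apply, Matrix.det_fin_two]
  ring

lemma jacobiSlash_mul_left {k m : ℤ} {f : ℂ → ℂ → ℂ} (hf : JacobiLaws k m SL2Z f)
    {γ M : Matrix (Fin 2) (Fin 2) ℤ} (hγ : γ.det = 1) (hM : 0 < M.det) (x : ℂ) {τ : ℂ}
    (hτ : 0 < τ.im) : jacobiSlash k m f (γ * M) x τ = jacobiSlash k m f M x τ := by
  have hJ := autDenom_ne_zero hM.ne' hτ
  have hτ' := moebiusAct_im_pos hM hτ
  have hJγ := autDenom_ne_zero (by simp [hγ] : γ.det ≠ 0) hτ'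
  have key := hf.1 γ hγ (M.det * x / autDenom M τ) (moebiusAct M τ) hτ'
  rw [← autDenom, ← moebiusAct] at key
  have hc := lowerLeft_mul_cocycle γ M τ
  rw [jacobiSlash, jacobiSlash, moebiusAct_mul _ _ hJ, Matrix.det_mul, hγ, one_mul]
  rw [autDenom_mul _ _ hJ] at hc ⊢
  set J := autDenom M τ
  set j := autDenom γ (moebiusAct M τ)
  rw [show (M.det : ℂ) * x / (j * J) = M.det * x / J / j by field_simp, key, mul_zpow,
    show -((m : ℂ) * M.det * M 1 0 * x ^ 2 / J) =
      -((m : ℂ) * M.det * (γ * M) 1 0 * x ^ 2 / (j * J)) + γ 1 0 * m * (M.det * x / J) ^ 2 / j by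
      field_simp
      linear_combination ((m : ℂ) * M.det * x ^ 2) * hc, eC_add, zpow_neg j]
  field_simp

lemma jacobiSlash_act {k m : ℤ} {f : ℂ → ℂ → ℂ}
    {γ M : Matrix (Fin 2) (Fin 2) ℤ} (hγ : γ.det = 1) (hM : 0 < M.det) (x : ℂ) {τ : ℂ}
    (hτ : 0 < τ.im) :
    jacobiSlash k m f M (x / autDenom γ τ) (moebiusAct γ τ) =
      autDenom γ τ ^ k * eC (γ 1 0 * (m * M.det) * x ^ 2 / autDenom γ τ) *
        jacobiSlash k m f (M * γ) x τ := by
  have hJ := autDenom_ne_zero (by simp [hγ] : γ.det ≠ 0) hτ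
  have hτ' := moebiusAct_im_pos (by simp [hγ] : 0 < γ.det) hτ
  have hJM := autDenom_ne_zero hM.ne' hτ'
  have hc := lowerLeft_mul_cocycle M γ τ
  rw [jacobiSlash, jacobiSlash, moebiusAct_mul _ _ hJ, Matrix.det_mul, hγ, mul_one]
  rw [autDenom_mul _ _ hJ, hγ, Int.cast_one, mul_one] at hc
  rw [autDenom_mul _ _ hJ]
  set J := autDenom γ τ
  set j := autDenom M (moebiusAct γ τ)
  rw [show (M.det : ℂ) * (x / J) / j = M.det * x / (j * J) by field_simp, mul_zpow,
    show -((m : ℂ) * M.det * M 1 0 * (x / J) ^ 2 / j) =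
      -((m : ℂ) * M.det * (M * γ) 1 0 * x ^ 2 / (j * J)) + γ 1 0 * (m * M.det) * x ^ 2 / J by
      field_simp
      linear_combination ((m : ℂ) * M.det * x ^ 2) * hc, eC_add, zpow_neg J]
  field_simp

/-- The index set of the upper-triangular coset representatives of determinant `d`. -/
def heckeIndex (d : ℕ) : Finset (Σ _ : ℕ, ℕ) := d.divisors.sigma fun a => Finset.range (d / a)

/-- The upper-triangular coset representatives of determinant `d`. -/
def heckeRep (d : ℕ) (p : Σ _ : ℕ, ℕ) : Matrix (Fin 2) (Fin 2) ℤ :=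
  !![(p.1 : ℤ), (p.2 : ℤ); 0, ((d / p.1 : ℕ) : ℤ)]

lemma mem_heckeIndex {d : ℕ} {p : Σ _ : ℕ, ℕ} :
    p ∈ heckeIndex d ↔ (p.1 ∣ d ∧ d ≠ 0) ∧ p.2 < d / p.1 := by
  simp [heckeIndex]

lemma det_heckeRep {d : ℕ} {p : Σ _ : ℕ, ℕ} (hp : p ∈ heckeIndex d) :
    (heckeRep d p).det = d := by
  obtain ⟨⟨h, -⟩, -⟩ := mem_heckeIndex.1 hp
  simp only [heckeRep, Matrix.det_fin_two_of, mul_zero, sub_zero]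
  exact_mod_cast Nat.mul_div_cancel' h

lemma exists_eq_mul_heckeRep {d : ℕ} (hd : 0 < d) {M : Matrix (Fin 2) (Fin 2) ℤ}
    (hM : M.det = d) :
    ∃ p ∈ heckeIndex d, ∃ γ : Matrix (Fin 2) (Fin 2) ℤ, γ.det = 1 ∧ M = γ * heckeRep d p := by
  obtain ⟨a, b, c, δ, rfl⟩ : ∃ a b c δ, M = !![a, b; c, δ] := ⟨_, _, _, _, Matrix.eta_fin_two M⟩
  rw [Matrix.det_fin_two_of] at hM
  have hg : 0 < Int.gcd a c := by
    rw [Int.gcd_pos_iff]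
    by_contra! h
    rw [h.1, h.2] at hM
    simp at hM
    omega
  obtain ⟨a', ha⟩ := Int.gcd_dvd_left a c
  obtain ⟨c', hc⟩ := Int.gcd_dvd_right a c
  have hbez := Int.gcd_eq_gcd_ab a c
  set g := Int.gcd a c
  set u := Int.gcdA a c
  set v := Int.gcdB a c
  have hg' : (0 : ℤ) < g := by exact_mod_cast hg
  have hbez' : a' * u + c' * v = 1 := by
    apply mul_left_cancel₀ hg'.ne'
    linear_combination -hbez - u * ha - v * hc
  have hgh : (g : ℤ) * (a' * δ - c' * b) = d := by
    linear_combination hM - δ * ha + b * hc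
  have hh : 0 < a' * δ - c' * b := by
    have : (0 : ℤ) < g * (a' * δ - c' * b) := by rw [hgh]; exact_mod_cast hd
    exact pos_of_mul_pos_right this hg'.le
  obtain ⟨h, hh_eq⟩ := Int.eq_ofNat_of_zero_le hh.le
  have hh0 : 0 < h := by omega
  have hghN : g * h = d := by rw [hh_eq] at hgh; exact_mod_cast hgh
  have hdiv : d / g = h := by rw [← hghN, Nat.mul_div_cancel_left _ hg]
  obtain ⟨r, hr⟩ := Int.eq_ofNat_of_zero_le
    (Int.emod_nonneg (u * b + v * δ) (by omega : (h : ℤ) ≠ 0))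
  have hrlt := Int.emod_lt_of_pos (u * b + v * δ) (by omega : (0 : ℤ) < h)
  have hq := Int.emod_add_mul_ediv (u * b + v * δ) h
  set q := (u * b + v * δ) / h
  rw [hr] at hq hrlt
  refine ⟨⟨g, r⟩, mem_heckeIndex.2 ⟨⟨⟨h, hghN.symm⟩, hd.ne'⟩, ?_⟩,
    !![a', -v + q * a'; c', u + q * c'], ?_, ?_⟩
  · simp only [hdiv]
    exact_mod_cast hrlt
  · rw [Matrix.det_fin_two_of]
    linear_combination hbez'
  · have h00 : a = a' * g := by linear_combination ha
    have h01 : b = a' * r + (-v + q * a') * h := by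
      linear_combination (-a') * hq - b * hbez' - v * hh_eq
    have h10 : c = c' * g := by linear_combination hc
    have h11 : δ = c' * r + (u + q * c') * h := by
      linear_combination (-c') * hq - δ * hbez' + u * hh_eq
    simp only [heckeRep, hdiv, Matrix.mul_fin_two, mul_zero, add_zero]
    rw [← h00, ← h01, ← h10, ← h11]

lemma heckeRep_injective_mod {d : ℕ} {p q : Σ _ : ℕ, ℕ} (hp : p ∈ heckeIndex d)
    (hq : q ∈ heckeIndex d) {γ : Matrix (Fin 2) (Fin 2) ℤ} (hγ : γ.det = 1)
    (h : heckeRep d p = γ * heckeRep d q) : p = q := by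
  obtain ⟨a, b⟩ := p
  obtain ⟨a', b'⟩ := q
  obtain ⟨⟨had, hd⟩, hb⟩ := mem_heckeIndex.1 hp
  obtain ⟨⟨had', -⟩, hb'⟩ := mem_heckeIndex.1 hq
  dsimp only at had had' hb hb'
  have ha0 := Nat.pos_of_dvd_of_pos had (Nat.pos_of_ne_zero hd)
  have ha0' := Nat.pos_of_dvd_of_pos had' (Nat.pos_of_ne_zero hd)
  have h00 := congrFun₂ h 0 0
  have h01 := congrFun₂ h 0 1
  have h10 := congrFun₂ h 1 0
  simp [heckeRep, Matrix.mul_apply] at h00 h01 h10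
  have h10' : γ 1 0 = 0 := by
    rcases h10 with h | h
    · exact h
    · omega
  rw [Matrix.det_fin_two, h10', mul_zero, sub_zero] at hγ
  have hγ00 : γ 0 0 = 1 := by
    have : 0 < γ 0 0 := by
      by_contra! hneg
      nlinarith
    exact Int.eq_one_of_mul_eq_one_right this.le hγ
  rw [hγ00, one_mul] at h00 h01
  obtain rfl : a = a' := by exact_mod_cast h00
  obtain rfl : b = b' := by
    norm_cast at h01
    generalize d / a = n at *
    zify at hb hb' ⊢
    have h1 : γ 0 1 < 1 := by by_contra! hh; nlinarith
    have h2 : -1 < γ 0 1 := by by_contra! hh; nlinarith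
    have h3 : γ 0 1 = 0 := by omega
    simpa [h3] using h01
  rfl

lemma heckeTransform_eq_sum_jacobiSlash (k m : ℤ) (f : ℂ → ℂ → ℂ) (d : ℕ) (x τ : ℂ) :
    heckeTransform k d f x τ =
      (d : ℂ) ^ (k - 1) * ∑ p ∈ heckeIndex d, jacobiSlash k m f (heckeRep d p) x τ := by
  rw [heckeTransform, Finset.sum_sigma', ← heckeIndex]
  congr 1
  refine Finset.sum_congr rfl fun p hp => ?_
  obtain ⟨⟨h, hd⟩, hb⟩ := mem_heckeIndex.1 hp
  have hn : ((d / p.1 : ℕ) : ℂ) ≠ 0 := by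
    have : d / p.1 ≠ 0 := by omega
    exact_mod_cast this
  have hdn : (d : ℂ) = p.1 * ((d / p.1 : ℕ) : ℂ) := by
    exact_mod_cast (Nat.mul_div_cancel' h).symm
  have hden : autDenom (heckeRep d p) τ = ((d / p.1 : ℕ) : ℂ) := by
    simp only [autDenom, heckeRep, Matrix.of_apply, Matrix.cons_val', Matrix.cons_val_zero,
      Matrix.cons_val_one, Matrix.cons_val_fin_one, Int.cast_zero, zero_mul, zero_add,
      Int.cast_natCast]
  have hlow : heckeRep d p 1 0 = 0 := by simp [heckeRep]
  rw [jacobiSlash, moebiusAct, hden, det_heckeRep hp, hlow, Int.cast_natCast]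
  have hx : (d : ℂ) * x / ((d / p.1 : ℕ) : ℂ) = p.1 * x := by
    rw [div_eq_iff hn]
    linear_combination x * hdn
  rw [hx]
  simp [heckeRep, eC]

lemma heckeTransform_jacobiLaws {k m : ℤ} {f : ℂ → ℂ → ℂ} (hf : JacobiLaws k m SL2Z f) {d : ℕ}
    (hd : 0 < d) : JacobiLaws k (m * d) SL2Z (heckeTransform k d f) := by
  refine ⟨fun γ hγ x τ hτ => ?_, fun x τ hτ l μ => ?_⟩
  · rw [← autDenom, ← moebiusAct, heckeTransform_eq_sum_jacobiSlash k m,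
      heckeTransform_eq_sum_jacobiSlash k m, mul_left_comm]
    congr 1
    rw [Finset.mul_sum]
    have hγ : γ.det = 1 := hγ
    have hdet : ∀ p ∈ heckeIndex d, (heckeRep d p * γ).det = d := fun p hp => by
      rw [Matrix.det_mul, det_heckeRep hp, hγ, mul_one]
    have hex : ∀ p, ∃ q, p ∈ heckeIndex d → q ∈ heckeIndex d ∧
        ∃ γ' : Matrix (Fin 2) (Fin 2) ℤ, γ'.det = 1 ∧
          heckeRep d p * γ = γ' * heckeRep d q := fun p => by
      by_cases hp : p ∈ heckeIndex d
      · obtain ⟨q, hq, h⟩ := exists_eq_mul_heckeRep hd (hdet p hp)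
        exact ⟨q, fun _ => ⟨hq, h⟩⟩
      · exact ⟨p, fun h => absurd h hp⟩
    choose σ hσ using hex
    have hmaps : Set.MapsTo σ (heckeIndex d) (heckeIndex d) := fun p hp => (hσ p hp).1
    have hinj : Set.InjOn σ (heckeIndex d) := fun p hp q hq hpq => by
      obtain ⟨-, γ₁, h₁, e₁⟩ := hσ p hp
      obtain ⟨-, γ₂, h₂, e₂⟩ := hσ q hq
      refine heckeRep_injective_mod hp hq (γ := γ₁ * γ₂⁻¹) ?_ ?_
      · simp [Matrix.det_mul, Matrix.det_nonsing_inv, h₁, h₂]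
      · have hu : IsUnit γ.det := by simp [hγ]
        have hu₂ : IsUnit γ₂.det := by simp [h₂]
        have hr : heckeRep d (σ q) = γ₂⁻¹ * (heckeRep d q * γ) := by
          rw [e₂, Matrix.nonsing_inv_mul_cancel_left _ _ hu₂]
        rw [hpq, hr] at e₁
        calc heckeRep d p = heckeRep d p * γ * γ⁻¹ := by
              rw [Matrix.mul_nonsing_inv_cancel_right _ _ hu]
          _ = γ₁ * γ₂⁻¹ * heckeRep d q := by
              rw [e₁, ← Matrix.mul_assoc, ← Matrix.mul_assoc,
                Matrix.mul_nonsing_inv_cancel_right _ _ hu]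
    refine Finset.sum_nbij σ hmaps hinj
      (Finset.surjOn_of_injOn_of_card_le σ hmaps hinj le_rfl) fun p hp => ?_
    obtain ⟨hq, γ', h', e⟩ := hσ p hp
    have hpos : ∀ q ∈ heckeIndex d, 0 < (heckeRep d q).det := fun q hq => by
      rw [det_heckeRep hq]
      exact_mod_cast hd
    rw [jacobiSlash_act hγ (hpos p hp) x hτ, e, jacobiSlash_mul_left hf h' (hpos _ hq) x hτ,
      det_heckeRep hp]
    push_cast
    rfl
  · rw [heckeTransform, heckeTransform, mul_left_comm]
    congr 1
    rw [Finset.mul_sum]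
    refine Finset.sum_congr rfl fun a ha => ?_
    rw [Finset.mul_sum]
    refine Finset.sum_congr rfl fun b hb => ?_
    rw [mul_left_comm]
    congr 1
    have had := Nat.dvd_of_mem_divisors ha
    have hn0 : 0 < d / a := Nat.div_pos (Nat.le_of_dvd hd had) (Nat.pos_of_dvd_of_pos had hd)
    have ha0 : 0 < a := Nat.pos_of_dvd_of_pos had hd
    have hdn : (d : ℂ) = a * ((d / a : ℕ) : ℂ) := by exact_mod_cast (Nat.mul_div_cancel' had).symm
    push_cast only [Int.cast_mul, Int.cast_natCast]
    rw [hdn]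
    generalize d / a = n at *
    have hn : (n : ℂ) ≠ 0 := by exact_mod_cast hn0.ne'
    have him : 0 < (((a : ℂ) * τ + b) / n).im := by
      rw [Complex.div_natCast_im]
      have : (0 : ℝ) < a := by exact_mod_cast ha0
      have : (0 : ℝ) < n := by exact_mod_cast hn0
      simp
      positivity
    have key := hf.2 (a * x) _ him (l * n) (a * μ - l * b)
    rw [show (a : ℂ) * (x + l * τ + μ) = a * x + ((l * n : ℤ) : ℂ) * ((a * τ + b) / n) +
      ((a * μ - l * b : ℤ) : ℂ) by push_cast; field_simp; ring, key]
    congr 1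
    rw [← eC_add_intCast _ (m * l ^ 2 * n * b)]
    congr 1
    push_cast
    field_simp
    ring

lemma jacobiLaws_rescale {k m : ℤ} {f : ℂ → ℂ → ℂ} (hf : JacobiLaws k m SL2Z f) {e N : ℕ}
    (he : 0 < e) (heN : e ∣ N) :
    JacobiLaws k (m * e) (Gamma0Set N) fun x τ => f (e * x) (e * τ) := by
  have him : ∀ τ : ℂ, 0 < τ.im → 0 < ((e : ℂ) * τ).im := fun τ hτ => by
    have : (0 : ℝ) < e := by exact_mod_cast he
    simp
    positivity
  refine ⟨fun A hA x τ hτ => ?_, fun x τ hτ l μ => ?_⟩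
  · obtain ⟨hdet, hN⟩ := hA
    obtain ⟨c, hc⟩ := (Int.natCast_dvd_natCast.2 heN).trans hN
    have key := hf.1 !![A 0 0, e * A 0 1; c, A 1 1]
      (by
        show Matrix.det _ = 1
        rw [Matrix.det_fin_two] at hdet
        rw [Matrix.det_fin_two_of]
        linear_combination hdet + A 0 1 * hc) (e * x) (e * τ) (him τ hτ)
    simp only [Matrix.of_apply, Matrix.cons_val', Matrix.cons_val_zero, Matrix.cons_val_one,
      Matrix.cons_val_fin_one] at key
    have hden : (c : ℂ) * (e * τ) + A 1 1 = A 1 0 * τ + A 1 1 := by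
      rw [hc]
      push_cast
      ring
    have harg : (A 0 0 : ℂ) * (e * τ) + ((e * A 0 1 : ℤ) : ℂ) = e * (A 0 0 * τ + A 0 1) := by
      push_cast
      ring
    rw [hden, harg, mul_div_assoc, mul_div_assoc] at key
    beta_reduce
    rw [key, hc]
    congr 3
    push_cast
    ring
  · have key := hf.2 (e * x) (e * τ) (him τ hτ) l (e * μ)
    beta_reduce
    rw [show (e : ℂ) * (x + l * τ + μ) = e * x + l * (e * τ) + ((e * μ : ℤ) : ℂ) by
      push_cast; ring, key]
    congr 2
    push_cast
    ring

lemma JacobiLaws.sum_const_mul {ι : Type*} {k m : ℤ} {Γ : Set (Matrix (Fin 2) (Fin 2) ℤ)}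
    (s : Finset ι) (c : ι → ℂ) {f : ι → ℂ → ℂ → ℂ} (hf : ∀ i ∈ s, JacobiLaws k m Γ (f i)) :
    JacobiLaws k m Γ fun x τ => ∑ i ∈ s, c i * f i x τ := by
  refine ⟨fun A hA x τ hτ => ?_, fun x τ hτ l μ => ?_⟩
  · simp only [Finset.mul_sum]
    refine Finset.sum_congr rfl fun i hi => ?_
    rw [(hf i hi).1 A hA x τ hτ]
    ring
  · simp only [Finset.mul_sum]
    refine Finset.sum_congr rfl fun i hi => ?_
    rw [(hf i hi).2 x τ hτ l μ]
    ring

/-- If `f` satisfies the weight-`k'`, index-`m` Jacobi transformation laws for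
`SL₂(ℤ)`, then the wrong-weight Hecke transform
`g(x,τ) = ∑_{e·d=ℓ} c_{k,k'}(e) (T_{k',d} f)(ex, eτ)` satisfies the weight-`k'`,
index-`mℓ` Jacobi transformation laws for `Γ₀(ℓ)`. -/
theorem wrong_weight_hecke_jacobiLaws (k k' m : ℤ) (ℓ : ℕ) (hℓ : 0 < ℓ)
    (f : ℂ → ℂ → ℂ) (hf : JacobiLaws k' m SL2Z f) :
    JacobiLaws k' (m * ℓ) (Gamma0Set ℓ)
      (fun x τ => ∑ e ∈ ℓ.divisors,
        cConst k k' e * heckeTransform k' (ℓ / e) f ((e : ℂ) * x) ((e : ℂ) * τ)) := by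
  refine JacobiLaws.sum_const_mul _ _ fun e he => ?_
  have hdvd := Nat.dvd_of_mem_divisors he
  have he0 := Nat.pos_of_dvd_of_pos hdvd hℓ
  have h := jacobiLaws_rescale
    (heckeTransform_jacobiLaws hf (Nat.div_pos (Nat.le_of_dvd hℓ hdvd) he0)) he0 hdvd
  rwa [mul_assoc, ← Nat.cast_mul, Nat.div_mul_cancel hdvd] at h
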